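/- Let k, m ≥ 1, T > 0, let a_1, …, a_{k+m} and b_1, …, b_{k+m} be nonzero real numbers, and let C = (c_{ij}) be a real k × m matrix which is a contraction, i.e. Σ_{i=1}^k (Σ_{j=1}^m c_{ij} x_j)^2 ≤ Σ_{j=1}^m x_j^2 for every x ∈ ℝ^m. Let u_1, …, u_k, v_1, …, v_m : ℝ × ℝ → ℝ be smooth, with ∂_t u_i = ∂_x^5 u_i for all x ≤ 0 and t ∈ [0,T], ∂_t v_j = ∂_x^5 v_j for all x ≥ 0 and t ∈ [0,T], each u_i having left-decay of order 5 on [0,T] and each v_j having right-decay of order 5 on [0,T], and suppose the Kawahara vertex conditions with data (a, b, C) hold on [0,T]. If u_i(x,0) = 0 for all x ≤ 0 and all 1 ≤ i ≤ k, and v_j(x,0) = 0 for all x ≥ 0 and all 1 ≤ j ≤ m, then u_i(x,t) = 0 for all x ≤ 0, t ∈ [0,T], 1 ≤ i ≤ k, and v_j(x,t) = 0 for all x ≥ 0, t ∈ [0,T], 1 ≤ j ≤ m. -/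

import Mathlib

open MeasureTheory Set Matrix

/-- `k`-th partial derivative in the first (space) variable of `w : ℝ × ℝ → ℝ`. -/
noncomputable def pdx (k : ℕ) (w : ℝ × ℝ → ℝ) (x t : ℝ) : ℝ :=
  iteratedDeriv k (fun y => w (y, t)) x

/-- Partial derivative in the second (time) variable of `w : ℝ × ℝ → ℝ`. -/
noncomputable def pdt (w : ℝ × ℝ → ℝ) (x t : ℝ) : ℝ :=
  deriv (fun s => w (x, s)) t

/-- `w` has left-decay of order 5 on `[0,T]`. -/
def LeftDecay5 (w : ℝ × ℝ → ℝ) (T : ℝ) : Prop :=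
  ∃ C > (0:ℝ), ∀ k ≤ 5, ∀ t ∈ Icc (0:ℝ) T, ∀ x ≤ (0:ℝ),
    |pdx k w x t| ≤ C * (1 + x ^ 2)⁻¹

/-- `w` has right-decay of order 5 on `[0,T]`. -/
def RightDecay5 (w : ℝ × ℝ → ℝ) (T : ℝ) : Prop :=
  ∃ C > (0:ℝ), ∀ k ≤ 5, ∀ t ∈ Icc (0:ℝ) T, ∀ x : ℝ, 0 ≤ x →
    |pdx k w x t| ≤ C * (1 + x ^ 2)⁻¹

/-- The Kawahara vertex conditions with data `(a, b, C)` on `[0,T]`,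
for the edge functions `u i` (edges `(-∞,0)`) and `v j` (edges `(0,∞)`).
The distinguished first edge is `u ⟨0, hk⟩`. -/
def KawaharaVertexConditions (k m : ℕ) (hk : 0 < k) (T : ℝ)
    (a b : Fin (k + m) → ℝ) (C : Matrix (Fin k) (Fin m) ℝ)
    (u : Fin k → ℝ × ℝ → ℝ) (v : Fin m → ℝ × ℝ → ℝ) : Prop :=
  ∀ t ∈ Icc (0:ℝ) T,
    (∀ i : Fin k, u ⟨0, hk⟩ (0, t) = a (Fin.castAdd m i) * u i (0, t)) ∧
    (∀ j : Fin m, u ⟨0, hk⟩ (0, t) = a (Fin.natAdd k j) * v j (0, t)) ∧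
    (∀ i : Fin k, pdx 1 (u ⟨0, hk⟩) 0 t = b (Fin.castAdd m i) * pdx 1 (u i) 0 t) ∧
    (∀ j : Fin m, pdx 1 (u ⟨0, hk⟩) 0 t = b (Fin.natAdd k j) * pdx 1 (v j) 0 t) ∧
    (∀ i : Fin k, pdx 2 (u i) 0 t = ∑ j : Fin m, C i j * pdx 2 (v j) 0 t) ∧
    (∑ i : Fin k, (b (Fin.castAdd m i))⁻¹ * pdx 3 (u i) 0 t
      = ∑ j : Fin m, (b (Fin.natAdd k j))⁻¹ * pdx 3 (v j) 0 t) ∧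
    (∑ i : Fin k, (a (Fin.castAdd m i))⁻¹ * pdx 4 (u i) 0 t
      = ∑ j : Fin m, (a (Fin.natAdd k j))⁻¹ * pdx 4 (v j) 0 t)

/-- The energy flux `w ∂ₓ⁴w - ∂ₓw ∂ₓ³w + (∂ₓ²w)² / 2`, a primitive in `x` of `w ∂ₓ⁵w`. -/
noncomputable def energyFlux (w : ℝ × ℝ → ℝ) (x t : ℝ) : ℝ :=
  w (x, t) * pdx 4 w x t - pdx 1 w x t * pdx 3 w x t + (pdx 2 w x t) ^ 2 / 2

lemma pdx_zero (w : ℝ × ℝ → ℝ) (x t : ℝ) : pdx 0 w x t = w (x, t) := by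
  simp [pdx]

lemma hasDerivAt_pdx {w : ℝ × ℝ → ℝ} (hw : ContDiff ℝ (⊤ : ℕ∞) w) (n : ℕ) (x t : ℝ) :
    HasDerivAt (fun y => pdx n w y t) (pdx (n + 1) w x t) x := by
  have hslice : ContDiff ℝ (⊤ : ℕ∞) (fun y => w (y, t)) :=
    hw.comp (contDiff_id.prodMk contDiff_const)
  have hd : Differentiable ℝ (iteratedDeriv n (fun y => w (y, t))) :=
    hslice.differentiable_iteratedDeriv n (by exact_mod_cast WithTop.coe_lt_top n)
  simpa [pdx, iteratedDeriv_succ] using (hd x).hasDerivAt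

lemma continuous_pdx {w : ℝ × ℝ → ℝ} (hw : ContDiff ℝ (⊤ : ℕ∞) w) (n : ℕ) (t : ℝ) :
    Continuous (fun y => pdx n w y t) :=
  continuous_iff_continuousAt.2 fun x => (hasDerivAt_pdx hw n x t).continuousAt

lemma hasDerivAt_pdt {w : ℝ × ℝ → ℝ} (hw : ContDiff ℝ (⊤ : ℕ∞) w) (x t : ℝ) :
    HasDerivAt (fun s => w (x, s)) (pdt w x t) t := by
  have hslice : ContDiff ℝ (⊤ : ℕ∞) (fun s => w (x, s)) :=
    hw.comp (contDiff_const.prodMk contDiff_id)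
  exact ((hslice.differentiable (by simp)) t).hasDerivAt

lemma continuous_pdt {w : ℝ × ℝ → ℝ} (hw : ContDiff ℝ (⊤ : ℕ∞) w) :
    Continuous (fun p : ℝ × ℝ => pdt w p.1 p.2) := by
  have h : (fun p : ℝ × ℝ => pdt w p.1 p.2) = fun p => fderiv ℝ w p (0, 1) := by
    funext p
    have h1 : HasFDerivAt w (fderiv ℝ w p) (p.1, p.2) :=
      (hw.differentiable (by simp) p).hasFDerivAt
    have h2 : HasDerivAt (fun s : ℝ => (p.1, s)) ((0 : ℝ), (1 : ℝ)) p.2 :=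
      (hasDerivAt_const p.2 p.1).prodMk (hasDerivAt_id p.2)
    exact (hasDerivAt_pdt hw p.1 p.2).unique (h1.comp_hasDerivAt p.2 h2)
  rw [h]
  exact (hw.continuous_fderiv (by simp)).clm_apply continuous_const

lemma hasDerivAt_energyFlux {w : ℝ × ℝ → ℝ} (hw : ContDiff ℝ (⊤ : ℕ∞) w) (x t : ℝ) :
    HasDerivAt (fun y => energyFlux w y t) (w (x, t) * pdx 5 w x t) x := by
  have h0 : HasDerivAt (fun y => w (y, t)) (pdx 1 w x t) x := by
    simpa only [pdx_zero] using hasDerivAt_pdx hw 0 x t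
  have h := ((h0.mul (hasDerivAt_pdx hw 4 x t)).sub
    ((hasDerivAt_pdx hw 1 x t).mul (hasDerivAt_pdx hw 3 x t))).add
    (((hasDerivAt_pdx hw 2 x t).pow 2).div_const 2)
  refine h.congr_deriv ?_
  norm_num
  ring

/-- Differentiation of the localized energy under the integral sign. -/
lemma hasDerivAt_integral_sq {w : ℝ × ℝ → ℝ} (hw : ContDiff ℝ (⊤ : ℕ∞) w) (p q t : ℝ) :
    HasDerivAt (fun s => ∫ x in p..q, (w (x, s)) ^ 2)
      (∫ x in p..q, 2 * w (x, t) * pdt w x t) t := by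
  have hF : Continuous (fun z : ℝ × ℝ => 2 * w z * pdt w z.1 z.2) :=
    (continuous_const.mul hw.continuous).mul (continuous_pdt hw)
  obtain ⟨M, hM⟩ := (isCompact_uIcc (a := p) (b := q)).prod
    (isCompact_closedBall t 1) |>.exists_bound_of_continuousOn hF.continuousOn
  have hsq (s : ℝ) : Continuous (fun x => (w (x, s)) ^ 2) :=
    (hw.continuous.comp (continuous_id.prodMk continuous_const)).pow 2
  refine (intervalIntegral.hasDerivAt_integral_of_dominated_loc_of_deriv_le
    (F := fun s x => (w (x, s)) ^ 2) (F' := fun s x => 2 * w (x, s) * pdt w x s)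
    (bound := fun _ => M) (Metric.closedBall_mem_nhds t one_pos) ?_ ?_ ?_ ?_ ?_ ?_).2
  · exact Filter.Eventually.of_forall fun s => (hsq s).aestronglyMeasurable
  · exact (hsq t).intervalIntegrable p q
  · exact (hF.comp (continuous_id.prodMk continuous_const)).aestronglyMeasurable
  · exact Filter.Eventually.of_forall fun x hx s hs =>
      hM (x, s) ⟨uIoc_subset_uIcc hx, hs⟩
  · exact intervalIntegrable_const
  · refine Filter.Eventually.of_forall fun x _ s _ => ?_
    refine ((hasDerivAt_pdt hw x s).pow 2).congr_deriv ?_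
    norm_num

/-- The local energy identity for `∂ₜw = ∂ₓ⁵w` on `[p, q]`. -/
lemma hasDerivAt_energy {w : ℝ × ℝ → ℝ} (hw : ContDiff ℝ (⊤ : ℕ∞) w) {p q t : ℝ}
    (hpq : p ≤ q) (heq : ∀ x ∈ Icc p q, pdt w x t = pdx 5 w x t) :
    HasDerivAt (fun s => ∫ x in p..q, (w (x, s)) ^ 2)
      (2 * (energyFlux w q t - energyFlux w p t)) t := by
  refine (hasDerivAt_integral_sq hw p q t).congr_deriv ?_
  have hint : IntervalIntegrable (fun x => w (x, t) * pdx 5 w x t) volume p q :=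
    ((hw.continuous.comp (continuous_id.prodMk continuous_const)).mul
      (continuous_pdx hw 5 t)).intervalIntegrable p q
  rw [← intervalIntegral.integral_eq_sub_of_hasDerivAt
    (fun x _ => hasDerivAt_energyFlux hw x t) hint, ← intervalIntegral.integral_const_mul]
  refine intervalIntegral.integral_congr fun x hx => ?_
  rw [uIcc_of_le hpq] at hx
  simp only [heq x hx]
  ring

lemma abs_energyFlux_le {w : ℝ × ℝ → ℝ} {x t K : ℝ}
    (h : ∀ n ≤ 5, |pdx n w x t| ≤ K * (1 + x ^ 2)⁻¹) :
    |energyFlux w x t| ≤ 3 * K ^ 2 * (1 + x ^ 2)⁻¹ := by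
  set r := (1 + x ^ 2)⁻¹ with hr
  have hr0 : 0 ≤ r := by positivity
  have hr1 : r ≤ 1 := inv_le_one_of_one_le₀ (by nlinarith [sq_nonneg x])
  have h0 := h 0 (by norm_num)
  rw [pdx_zero] at h0
  have hprod {y z : ℝ} (hy : |y| ≤ K * r) (hz : |z| ≤ K * r) : |y * z| ≤ (K * r) * (K * r) := by
    rw [abs_mul]
    exact mul_le_mul hy hz (abs_nonneg z) ((abs_nonneg y).trans hy)
  have h04 := abs_le.1 (hprod h0 (h 4 (by norm_num)))
  have h13 := abs_le.1 (hprod (h 1 (by norm_num)) (h 3 (by norm_num)))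
  have h22 := abs_le.1 (hprod (h 2 (by norm_num)) (h 2 (by norm_num)))
  have hrr : (K * r) * (K * r) ≤ K ^ 2 * r := by
    nlinarith [mul_nonneg (sq_nonneg K) (mul_nonneg hr0 (sub_nonneg.2 hr1))]
  have hKr : 0 ≤ (K * r) * (K * r) := mul_self_nonneg _
  unfold energyFlux
  rw [abs_le]
  constructor <;> nlinarith

lemma LeftDecay5.exists_abs_energyFlux_le {w : ℝ × ℝ → ℝ} {T : ℝ} (h : LeftDecay5 w T) :
    ∃ K, ∀ t ∈ Icc (0 : ℝ) T, ∀ x ≤ (0 : ℝ), |energyFlux w x t| ≤ K * (1 + x ^ 2)⁻¹ := by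
  obtain ⟨K, -, hK⟩ := h
  exact ⟨3 * K ^ 2, fun t ht x hx => abs_energyFlux_le fun n hn => hK n hn t ht x hx⟩

lemma RightDecay5.exists_abs_energyFlux_le {w : ℝ × ℝ → ℝ} {T : ℝ} (h : RightDecay5 w T) :
    ∃ K, ∀ t ∈ Icc (0 : ℝ) T, ∀ x : ℝ, 0 ≤ x → |energyFlux w x t| ≤ K * (1 + x ^ 2)⁻¹ := by
  obtain ⟨K, -, hK⟩ := h
  exact ⟨3 * K ^ 2, fun t ht x hx => abs_energyFlux_le fun n hn => hK n hn t ht x hx⟩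

/-- The vertex conditions with a contractive coupling matrix make the vertex dissipative. -/
lemma KawaharaVertexConditions.sum_energyFlux_le {k m : ℕ} {hk : 0 < k} {T : ℝ}
    {a b : Fin (k + m) → ℝ} {C : Matrix (Fin k) (Fin m) ℝ}
    {u : Fin k → ℝ × ℝ → ℝ} {v : Fin m → ℝ × ℝ → ℝ}
    (h : KawaharaVertexConditions k m hk T a b C u v)
    (ha : ∀ i, a i ≠ 0) (hb : ∀ i, b i ≠ 0)
    (hC : ∀ x : Fin m → ℝ,
      ∑ i : Fin k, (∑ j : Fin m, C i j * x j) ^ 2 ≤ ∑ j : Fin m, (x j) ^ 2)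
    {t : ℝ} (ht : t ∈ Icc (0 : ℝ) T) :
    ∑ i, energyFlux (u i) 0 t ≤ ∑ j, energyFlux (v j) 0 t := by
  obtain ⟨hau, hav, hbu, hbv, h2, h3, h4⟩ := h t ht
  have hflux {w : ℝ × ℝ → ℝ} {α β A B : ℝ} (hα : α ≠ 0) (hβ : β ≠ 0)
      (hA : A = α * w (0, t)) (hB : B = β * pdx 1 w 0 t) :
      energyFlux w 0 t = A * (α⁻¹ * pdx 4 w 0 t) - B * (β⁻¹ * pdx 3 w 0 t)
        + (pdx 2 w 0 t) ^ 2 / 2 := by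
    rw [hA, hB, energyFlux]
    field_simp
  rw [Finset.sum_congr rfl fun i _ => hflux (ha _) (hb _) (hau i) (hbu i),
    Finset.sum_congr rfl fun j _ => hflux (ha _) (hb _) (hav j) (hbv j)]
  simp only [Finset.sum_add_distrib, Finset.sum_sub_distrib, ← Finset.mul_sum,
    ← Finset.sum_div, h3, h4]
  have hC2 := hC fun j => pdx 2 (v j) 0 t
  simp only [← h2] at hC2
  linarith

/-- A continuous function whose square has nonpositive integral over `[p, q]` vanishes there. -/
lemma eq_zero_of_integral_sq_nonpos {f : ℝ → ℝ} (hf : Continuous f) {p q : ℝ} (hpq : p < q)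
    (h : ∫ x in p..q, (f x) ^ 2 ≤ 0) : ∀ x ∈ Icc p q, f x = 0 := by
  intro x hx
  by_contra hne
  exact absurd (intervalIntegral.integral_pos hpq (hf.pow 2).continuousOn
    (fun y _ => sq_nonneg (f y)) ⟨x, hx, sq_pos_of_ne_zero hne⟩) (not_lt.2 h)

/-- Uniqueness for the linearized Kawahara system on a star graph with `k`
incoming and `m` outgoing edges: smooth decaying solutions satisfying the
vertex conditions with a contractive coupling matrix and vanishing at `t = 0`
vanish identically. -/
theorem kawahara_star_uniqueness
    (k m : ℕ) (hk : 0 < k) (hm : 0 < m) (T : ℝ) (hT : 0 < T)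
    (a b : Fin (k + m) → ℝ) (ha : ∀ i, a i ≠ 0) (hb : ∀ i, b i ≠ 0)
    (C : Matrix (Fin k) (Fin m) ℝ)
    (hC : ∀ x : Fin m → ℝ,
      ∑ i : Fin k, (∑ j : Fin m, C i j * x j) ^ 2 ≤ ∑ j : Fin m, (x j) ^ 2)
    (u : Fin k → ℝ × ℝ → ℝ) (v : Fin m → ℝ × ℝ → ℝ)
    (hu_smooth : ∀ i, ContDiff ℝ (⊤ : ℕ∞) (u i))
    (hv_smooth : ∀ j, ContDiff ℝ (⊤ : ℕ∞) (v j))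
    (hu_eq : ∀ i, ∀ x ≤ (0:ℝ), ∀ t ∈ Icc (0:ℝ) T, pdt (u i) x t = pdx 5 (u i) x t)
    (hv_eq : ∀ j, ∀ x : ℝ, 0 ≤ x → ∀ t ∈ Icc (0:ℝ) T, pdt (v j) x t = pdx 5 (v j) x t)
    (hu_dec : ∀ i, LeftDecay5 (u i) T)
    (hv_dec : ∀ j, RightDecay5 (v j) T)
    (hvc : KawaharaVertexConditions k m hk T a b C u v)
    (hu0 : ∀ i : Fin k, ∀ x ≤ (0:ℝ), u i (x, 0) = 0)
    (hv0 : ∀ j : Fin m, ∀ x : ℝ, 0 ≤ x → v j (x, 0) = 0) :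
    (∀ i : Fin k, ∀ x ≤ (0:ℝ), ∀ t ∈ Icc (0:ℝ) T, u i (x, t) = 0) ∧
    (∀ j : Fin m, ∀ x : ℝ, 0 ≤ x → ∀ t ∈ Icc (0:ℝ) T, v j (x, t) = 0) := by
  choose K hK using fun i => (hu_dec i).exists_abs_energyFlux_le
  choose L hL using fun j => (hv_dec j).exists_abs_energyFlux_le
  set M : ℝ := ∑ i, K i + ∑ j, L j
  set E : ℝ → ℝ → ℝ := fun R t =>
    ∑ i, (∫ x in (-R)..0, (u i (x, t)) ^ 2) + ∑ j, (∫ x in (0 : ℝ)..R, (v j (x, t)) ^ 2)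
  have hE (R : ℝ) (hR : 0 ≤ R) (t : ℝ) (ht : t ∈ Icc (0 : ℝ) T) :
      HasDerivAt (E R) (∑ i, 2 * (energyFlux (u i) 0 t - energyFlux (u i) (-R) t)
        + ∑ j, 2 * (energyFlux (v j) R t - energyFlux (v j) 0 t)) t := by
    refine HasDerivAt.add (HasDerivAt.fun_sum fun i _ => ?_) (HasDerivAt.fun_sum fun j _ => ?_)
    · exact hasDerivAt_energy (hu_smooth i) (by linarith) fun x hx => hu_eq i x hx.2 t ht
    · exact hasDerivAt_energy (hv_smooth j) hR fun x hx => hv_eq j x hx.1 t ht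
  have hE' (R : ℝ) (hR : 0 ≤ R) (t : ℝ) (ht : t ∈ Icc (0 : ℝ) T) :
      ∑ i, 2 * (energyFlux (u i) 0 t - energyFlux (u i) (-R) t)
        + ∑ j, 2 * (energyFlux (v j) R t - energyFlux (v j) 0 t) ≤ 2 * M * (1 + R ^ 2)⁻¹ := by
    have h0 := hvc.sum_energyFlux_le ha hb hC ht
    have h1 : -∑ i, energyFlux (u i) (-R) t ≤ (∑ i, K i) * (1 + R ^ 2)⁻¹ := by
      rw [Finset.sum_mul, ← Finset.sum_neg_distrib]
      refine Finset.sum_le_sum fun i _ => (neg_le_abs _).trans ?_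
      simpa using hK i t ht (-R) (by linarith)
    have h2 : ∑ j, energyFlux (v j) R t ≤ (∑ j, L j) * (1 + R ^ 2)⁻¹ := by
      rw [Finset.sum_mul]
      exact Finset.sum_le_sum fun j _ => (le_abs_self _).trans (hL j t ht R hR)
    simp only [← Finset.mul_sum, Finset.sum_sub_distrib]
    have hM : M * (1 + R ^ 2)⁻¹ = (∑ i, K i) * (1 + R ^ 2)⁻¹ + (∑ j, L j) * (1 + R ^ 2)⁻¹ :=
      add_mul _ _ _
    linarith
  have hE0 (R : ℝ) (hR : 0 ≤ R) : E R 0 = 0 := by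
    have h1 (i : Fin k) : ∫ x in (-R)..0, (u i (x, 0)) ^ 2 = 0 := by
      refine (intervalIntegral.integral_congr (g := fun _ => 0) fun x hx => ?_).trans (by simp)
      rw [uIcc_of_le (by linarith)] at hx
      simp [hu0 i x hx.2]
    have h2 (j : Fin m) : ∫ x in (0 : ℝ)..R, (v j (x, 0)) ^ 2 = 0 := by
      refine (intervalIntegral.integral_congr (g := fun _ => 0) fun x hx => ?_).trans (by simp)
      rw [uIcc_of_le hR] at hx
      simp [hv0 j x hx.1]
    simp [E, h1, h2]
  have hbound (R : ℝ) (hR : 0 ≤ R) (t : ℝ) (ht : t ∈ Icc (0 : ℝ) T) :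
      E R t ≤ 2 * M * (1 + R ^ 2)⁻¹ * t := by
    refine image_le_of_deriv_right_le_deriv_boundary (a := 0) (b := T)
      (fun s hs => (hE R hR s hs).continuousAt.continuousWithinAt)
      (fun s hs => (hE R hR s (Ico_subset_Icc_self hs)).hasDerivWithinAt)
      (by simp [hE0 R hR]) (by fun_prop)
      (fun s _ => ((hasDerivAt_id s).const_mul (2 * M * (1 + R ^ 2)⁻¹)).hasDerivWithinAt)
      (fun s hs => ?_) ht
    simpa using hE' R hR s (Ico_subset_Icc_self hs)
  have hlim (t : ℝ) :
      Filter.Tendsto (fun R : ℝ => 2 * M * (1 + R ^ 2)⁻¹ * t) Filter.atTop (nhds 0) := by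
    have h : Filter.Tendsto (fun R : ℝ => (1 + R ^ 2)⁻¹) Filter.atTop (nhds 0) :=
      (Filter.tendsto_atTop_add_const_left _ _
        (Filter.tendsto_pow_atTop two_ne_zero)).inv_tendsto_atTop
    simpa using (h.const_mul (2 * M)).mul_const t
  have hmono {f : ℝ → ℝ} (hf : Continuous f) {p q p' q' : ℝ} (hp : p' ≤ p) (hpq : p ≤ q)
      (hq : q ≤ q') : ∫ x in p..q, (f x) ^ 2 ≤ ∫ x in p'..q', (f x) ^ 2 :=
    intervalIntegral.integral_mono_interval hp hpq hq
      (Filter.Eventually.of_forall fun x => sq_nonneg (f x))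
      ((hf.pow 2).intervalIntegrable _ _)
  have hnonneg (f : ℝ → ℝ) {p q : ℝ} (hpq : p ≤ q) : 0 ≤ ∫ x in p..q, (f x) ^ 2 :=
    intervalIntegral.integral_nonneg hpq fun x _ => sq_nonneg (f x)
  have hcu (i : Fin k) (t : ℝ) : Continuous fun x => u i (x, t) :=
    (hu_smooth i).continuous.comp (continuous_id.prodMk continuous_const)
  have hcv (j : Fin m) (t : ℝ) : Continuous fun x => v j (x, t) :=
    (hv_smooth j).continuous.comp (continuous_id.prodMk continuous_const)
  constructor
  · intro i x hx t ht
    refine eq_zero_of_integral_sq_nonpos (hcu i t) (p := x - 1) (q := 0) (by linarith) ?_ x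
      ⟨by linarith, hx⟩
    refine ge_of_tendsto (hlim t) ?_
    filter_upwards [Filter.eventually_ge_atTop (1 - x)] with R hR
    refine le_trans ?_ (hbound R (by linarith) t ht)
    refine (hmono (hcu i t) (p' := -R) (by linarith) (by linarith) le_rfl).trans ?_
    refine (Finset.single_le_sum (f := fun i => ∫ x in (-R)..0, (u i (x, t)) ^ 2)
      (fun i _ => hnonneg _ (by linarith)) (Finset.mem_univ i)).trans ?_
    exact le_add_of_nonneg_right (Finset.sum_nonneg fun j _ => hnonneg _ (by linarith))
  · intro j x hx t ht
    refine eq_zero_of_integral_sq_nonpos (hcv j t) (p := 0) (q := x + 1) (by linarith) ?_ x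
      ⟨hx, by linarith⟩
    refine ge_of_tendsto (hlim t) ?_
    filter_upwards [Filter.eventually_ge_atTop (x + 1)] with R hR
    refine le_trans ?_ (hbound R (by linarith) t ht)
    refine (hmono (hcv j t) (q' := R) le_rfl (by linarith) (by linarith)).trans ?_
    refine (Finset.single_le_sum (f := fun j => ∫ x in (0 : ℝ)..R, (v j (x, t)) ^ 2)
      (fun j _ => hnonneg _ (by linarith)) (Finset.mem_univ j)).trans ?_
    exact le_add_of_nonneg_left (Finset.sum_nonneg fun i _ => hnonneg _ (by linarith))
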